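/- Let w : ℕ → (0,∞) satisfy w(m+n) ≤ w(m)·w(n) for all m, n ∈ ℕ (where ℕ includes 0). Let f : ℕ → ℂ with sup_n |f(n)| w(n) < ∞, and let k : ℕ → ℂ with Σ_{n=0}^∞ |k(n)| w(n) < ∞. Assume that Σ_{n=0}^∞ k(n) zⁿ ≠ 0 for every z ∈ ℂ with |z| ≤ inf_{n≥1} w(n)^{1/n}. If (Σ_{i=0}^{n} f(i) k(n−i))·w(n) → 0 as n → ∞, then f(n)·w(n) → 0 as n → ∞. -/

import Mathlib

open scoped ZeroAtInfty
open Filter Topology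

/-- A power series with absolutely summable terms in an element `a` of a complex Banach algebra is
invertible if its symbol has no zero `z` with `‖z‖ ^ n ≤ ‖a ^ n‖` for all `n`. -/
theorem isUnit_tsum_smul_pow {A : Type*} [NormedRing A] [NormOneClass A] [NormedAlgebra ℂ A]
    [CompleteSpace A] (a : A) (c : ℕ → ℂ) (hc : Summable fun n => ‖c n • a ^ n‖)
    (hz : ∀ z : ℂ, (∀ n, ‖z‖ ^ n ≤ ‖a ^ n‖) → ∑' n, c n * z ^ n ≠ 0) :
    IsUnit (∑' n, c n • a ^ n) := by
  let B := Algebra.elemental ℂ a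
  let b : B := ⟨a, Algebra.elemental.self_mem ℂ a⟩
  let : NormedCommRing B :=
    { (inferInstance : NormedRing B) with
      mul_comm := (inferInstance : CommRing B).mul_comm }
  have : CompleteSpace B := (Algebra.elemental.isClosed ℂ a).completeSpace_coe
  have : NormOneClass B := ⟨norm_one (α := A)⟩
  have hs : Summable fun n => c n • b ^ n := Summable.of_norm hc
  have hB : IsUnit (∑' n, c n • b ^ n) := by
    by_contra hB
    obtain ⟨φ, hφ⟩ := WeakDual.CharacterSpace.exists_apply_eq_zero hB
    refine hz (φ b) (fun n => ?_) ?_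
    · rw [← norm_pow, ← map_pow]
      exact AlgHom.norm_apply_le_self φ (b ^ n)
    · have h := (hs.hasSum.map φ (map_continuous φ)).tsum_eq
      rw [hφ] at h
      rw [← h]
      simp
  have hsum : ((∑' n, c n • b ^ n : B) : A) = ∑' n, c n • a ^ n :=
    ((hs.hasSum.map B.val continuous_subtype_val).tsum_eq).symm
  rw [← hsum]
  exact hB.map B.val

/-- The operator `∑ c n • T ^ n` is surjective if its symbol has no zero `z` with `‖z‖ ^ n ≤ v n`
for all `n`, where `v` dominates the norms of the powers of `T`. -/
theorem exists_hasSum_smul_pow_apply {E : Type*} [NormedAddCommGroup E] [NormedSpace ℂ E]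
    [CompleteSpace E] [Nontrivial E] (T : E →L[ℂ] E) (c : ℕ → ℂ) {v : ℕ → ℝ}
    (hT : ∀ n, ‖T ^ n‖ ≤ v n) (hc : Summable fun n => ‖c n‖ * v n)
    (hz : ∀ z : ℂ, (∀ n, ‖z‖ ^ n ≤ v n) → ∑' n, c n * z ^ n ≠ 0) (y : E) :
    ∃ x, HasSum (fun n => c n • (T ^ n) x) y := by
  have hs : Summable fun n => ‖c n • T ^ n‖ := by
    refine Summable.of_nonneg_of_le (fun n => norm_nonneg (c n • T ^ n)) (fun n => ?_) hc
    rw [norm_smul]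
    exact mul_le_mul_of_nonneg_left (hT n) (norm_nonneg _)
  obtain ⟨S, hS⟩ := (isUnit_tsum_smul_pow T c hs fun z h =>
    hz z fun n => (h n).trans (hT n)).exists_right_inv
  refine ⟨S y, ?_⟩
  have h := hs.of_norm.hasSum.mapL (ContinuousLinearMap.apply ℂ E (S y))
  have hy : (∑' n, c n • T ^ n) (S y) = y := DFunLike.congr_fun hS y
  rwa [ContinuousLinearMap.apply_apply, hy] at h

/-- Translation by `m`, conjugated by multiplication by `w`: the sequence `g n * w n` is sent to
`g (n - m) * w n` for `m ≤ n`, and to zero for `n < m`. -/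
noncomputable def weightedTranslate (w : ℕ → ℝ) (m : ℕ) (y : ℕ → ℂ) (n : ℕ) : ℂ :=
  if m ≤ n then ((w n / w (n - m) : ℝ) : ℂ) * y (n - m) else 0

theorem norm_weightedTranslate_le {w : ℕ → ℝ} (hw_pos : ∀ n, 0 < w n)
    (hw_sub : ∀ m n, w (m + n) ≤ w m * w n) (m : ℕ) (y : ℕ → ℂ) (n : ℕ) :
    ‖weightedTranslate w m y n‖ ≤ w m * ‖y (n - m)‖ := by
  unfold weightedTranslate
  split_ifs with h
  · rw [norm_mul, Complex.norm_real, Real.norm_of_nonneg (div_pos (hw_pos _) (hw_pos _)).le]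
    gcongr
    rw [div_le_iff₀ (hw_pos _)]
    simpa [Nat.add_sub_cancel' h] using hw_sub m (n - m)
  · rw [norm_zero]
    exact mul_nonneg (hw_pos m).le (norm_nonneg _)

theorem weightedTranslate_zero {w : ℕ → ℝ} (hw_pos : ∀ n, 0 < w n) (y : ℕ → ℂ) :
    weightedTranslate w 0 y = y := by
  ext n
  simp [weightedTranslate, (hw_pos n).ne']

theorem weightedTranslate_succ {w : ℕ → ℝ} (hw_pos : ∀ n, 0 < w n) (m : ℕ) (y : ℕ → ℂ) :
    weightedTranslate w (m + 1) y = weightedTranslate w m (weightedTranslate w 1 y) := by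
  ext n
  unfold weightedTranslate
  by_cases h : m + 1 ≤ n
  · have h₁ : m ≤ n := by omega
    have h₂ : 1 ≤ n - m := by omega
    have h₃ : (w (n - m) : ℂ) ≠ 0 := by exact_mod_cast (hw_pos _).ne'
    have h₄ : (w (n - m - 1) : ℂ) ≠ 0 := by exact_mod_cast (hw_pos _).ne'
    simp only [h, h₁, h₂, if_true, ← Nat.sub_sub]
    push_cast
    field_simp
  · by_cases h₁ : m ≤ n
    · have h₂ : ¬ 1 ≤ n - m := by omega
      simp [h, h₂]
    · simp [h, h₁]

theorem ZeroAtInftyContinuousMap.norm_apply_le {α : Type*} [TopologicalSpace α]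
    (y : C₀(α, ℂ)) (n : α) : ‖y n‖ ≤ ‖y‖ :=
  y.toBCF.norm_coe_le_norm n

theorem ZeroAtInftyContinuousMap.norm_le_of_forall {α : Type*} [TopologicalSpace α]
    {y : C₀(α, ℂ)} {C : ℝ} (hC : 0 ≤ C) (h : ∀ n, ‖y n‖ ≤ C) : ‖y‖ ≤ C :=
  (y.toBCF.norm_le hC).2 h

/-- Evaluation at a point as a continuous linear functional. -/
noncomputable def ZeroAtInftyContinuousMap.evalCLM {α : Type*} [TopologicalSpace α] (n : α) :
    C₀(α, ℂ) →L[ℂ] ℂ :=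
  LinearMap.mkContinuous
    { toFun := fun y => y n
      map_add' := fun _ _ => rfl
      map_smul' := fun _ _ => rfl } 1 fun y => by simpa using y.norm_apply_le n

/-- The null sequence given by a function on `ℕ` tending to zero. -/
def ZeroAtInftyContinuousMap.ofTendsto (y : ℕ → ℂ) (hy : Tendsto y atTop (𝓝 0)) : C₀(ℕ, ℂ) where
  toFun := y
  continuous_toFun := continuous_of_discreteTopology
  zero_at_infty' := by rwa [cocompact_eq_atTop]

theorem ZeroAtInftyContinuousMap.tendsto_atTop (y : C₀(ℕ, ℂ)) : Tendsto y atTop (𝓝 0) :=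
  cocompact_eq_atTop (α := ℕ) ▸ zero_at_infty y

theorem tendsto_weightedTranslate {w : ℕ → ℝ} (hw_pos : ∀ n, 0 < w n)
    (hw_sub : ∀ m n, w (m + n) ≤ w m * w n) (m : ℕ) {y : ℕ → ℂ} (hy : Tendsto y atTop (𝓝 0)) :
    Tendsto (weightedTranslate w m y) atTop (𝓝 0) := by
  refine squeeze_zero_norm (norm_weightedTranslate_le hw_pos hw_sub m y) ?_
  simpa using ((hy.comp (tendsto_sub_atTop_nat m)).norm).const_mul (w m)

/-- The weighted translation by `m` as a bounded operator on null sequences. -/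
noncomputable def weightedTranslateCLM {w : ℕ → ℝ} (hw_pos : ∀ n, 0 < w n)
    (hw_sub : ∀ m n, w (m + n) ≤ w m * w n) (m : ℕ) : C₀(ℕ, ℂ) →L[ℂ] C₀(ℕ, ℂ) :=
  LinearMap.mkContinuous
    { toFun := fun y => .ofTendsto (weightedTranslate w m y)
        (tendsto_weightedTranslate hw_pos hw_sub m y.tendsto_atTop)
      map_add' := fun x y => by
        ext n
        change weightedTranslate w m (x + y) n =
          weightedTranslate w m x n + weightedTranslate w m y n
        unfold weightedTranslate
        split_ifs <;> simp [mul_add]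
      map_smul' := fun c y => by
        ext n
        change weightedTranslate w m (c • y) n = c * weightedTranslate w m y n
        unfold weightedTranslate
        split_ifs <;> simp [mul_left_comm] }
    (w m) fun y => ZeroAtInftyContinuousMap.norm_le_of_forall
      (mul_nonneg (hw_pos m).le (norm_nonneg y)) fun n =>
      (norm_weightedTranslate_le hw_pos hw_sub m y n).trans
        (mul_le_mul_of_nonneg_left (y.norm_apply_le _) (hw_pos m).le)

section

variable {w : ℕ → ℝ} (hw_pos : ∀ n, 0 < w n) (hw_sub : ∀ m n, w (m + n) ≤ w m * w n)

theorem coe_weightedTranslateCLM (m : ℕ) (y : C₀(ℕ, ℂ)) :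
    ⇑(weightedTranslateCLM hw_pos hw_sub m y) = weightedTranslate w m y :=
  rfl

theorem norm_weightedTranslateCLM_le (m : ℕ) : ‖weightedTranslateCLM hw_pos hw_sub m‖ ≤ w m :=
  LinearMap.mkContinuous_norm_le _ (hw_pos m).le _

theorem weightedTranslateCLM_one_pow (m : ℕ) :
    weightedTranslateCLM hw_pos hw_sub 1 ^ m = weightedTranslateCLM hw_pos hw_sub m := by
  induction m with
  | zero =>
    ext y n
    rw [coe_weightedTranslateCLM, weightedTranslate_zero hw_pos]
    rfl
  | succ m ih =>
    ext y n
    rw [pow_succ, ih, coe_weightedTranslateCLM, weightedTranslate_succ hw_pos]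
    rfl

end

theorem le_iInf_rpow_inv {w : ℕ → ℝ} {r : ℝ} (hr : 0 ≤ r) (h : ∀ n, r ^ n ≤ w n) :
    r ≤ ⨅ n : {m : ℕ // 1 ≤ m}, (w n.1) ^ ((n.1 : ℝ)⁻¹) := by
  have : Nonempty {m : ℕ // 1 ≤ m} := ⟨⟨1, le_rfl⟩⟩
  refine le_ciInf fun n => ?_
  calc r = (r ^ n.1) ^ ((n.1 : ℝ)⁻¹) :=
        (Real.pow_rpow_inv_natCast hr (Nat.one_le_iff_ne_zero.1 n.2)).symm
    _ ≤ _ := Real.rpow_le_rpow (pow_nonneg hr _) (h _) (by positivity)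

/-- Weighted convolution by `k` is surjective on null sequences when the generating function of `k`
has no zero in the disc of radius `inf w(n)^{1/n}`. -/
theorem exists_tsum_weightedTranslate_eq {w : ℕ → ℝ} (hw_pos : ∀ n, 0 < w n)
    (hw_sub : ∀ m n, w (m + n) ≤ w m * w n) {k : ℕ → ℂ} (hk : Summable fun n => ‖k n‖ * w n)
    (hz : ∀ z : ℂ, ‖z‖ ≤ (⨅ n : {m : ℕ // 1 ≤ m}, (w n.1) ^ ((n.1 : ℝ)⁻¹)) →
      (∑' n : ℕ, k n * z ^ n) ≠ 0) {h : ℕ → ℂ} (hh : Tendsto h atTop (𝓝 0)) :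
    ∃ x : C₀(ℕ, ℂ), ∀ n, ∑' m, k m * weightedTranslate w m x n = h n := by
  have hnt : Nontrivial C₀(ℕ, ℂ) := by
    refine ⟨.ofTendsto (fun n => if n = 0 then 1 else 0) ?_, 0, fun h => ?_⟩
    · refine tendsto_const_nhds.congr' ?_
      filter_upwards [eventually_ne_atTop 0] with n hn
      simp [hn]
    · simpa [ZeroAtInftyContinuousMap.ofTendsto] using DFunLike.congr_fun h 0
  have hpow := weightedTranslateCLM_one_pow hw_pos hw_sub
  obtain ⟨x, hx⟩ := exists_hasSum_smul_pow_apply (weightedTranslateCLM hw_pos hw_sub 1) k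
    (fun n => (congrArg norm (hpow n)).trans_le (norm_weightedTranslateCLM_le hw_pos hw_sub n)) hk
    (fun z h => hz z (le_iInf_rpow_inv (norm_nonneg z) h)) (.ofTendsto h hh)
  simp only [hpow] at hx
  exact ⟨x, fun n => (hx.mapL (ZeroAtInftyContinuousMap.evalCLM n)).tsum_eq⟩

/-- Tauberian theorem for the additive semigroup `ℕ` with a weight `w`:
if `Σ k(n) zⁿ ≠ 0` for all `|z| ≤ inf_{n≥1} w(n)^{1/n}` and the convolution
`(f∗k)(n)·w(n) → 0`, then `f(n)·w(n) → 0`. -/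
theorem tauberian_nat (w : ℕ → ℝ) (f k : ℕ → ℂ)
    (hw_pos : ∀ n, 0 < w n)
    (hw_sub : ∀ m n, w (m + n) ≤ w m * w n)
    (hf : ∃ C, ∀ n, ‖f n‖ * w n ≤ C)
    (hk : Summable fun n => ‖k n‖ * w n)
    (hz : ∀ z : ℂ, ‖z‖ ≤ (⨅ n : {m : ℕ // 1 ≤ m}, (w n.1) ^ ((n.1 : ℝ)⁻¹)) →
      (∑' n : ℕ, k n * z ^ n) ≠ 0)
    (h0 : Filter.Tendsto
      (fun n : ℕ => (∑ i ∈ Finset.range (n + 1), f i * k (n - i)) * (w n : ℂ))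
      Filter.atTop (nhds 0)) :
    Filter.Tendsto (fun n : ℕ => f n * (w n : ℂ)) Filter.atTop (nhds 0) := by
  obtain ⟨x, hval⟩ := exists_tsum_weightedTranslate_eq hw_pos hw_sub hk hz h0
  have hwc : ∀ n, (w n : ℂ) ≠ 0 := fun n => by exact_mod_cast (hw_pos n).ne'
  have hmul : PowerSeries.mk k * PowerSeries.mk (fun n => x n / w n) =
      PowerSeries.mk k * PowerSeries.mk f := by
    rw [mul_comm _ (PowerSeries.mk f)]
    ext n
    simp only [PowerSeries.coeff_mul, PowerSeries.coeff_mk]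
    rw [Finset.Nat.sum_antidiagonal_eq_sum_range_succ (fun i j => f i * k j),
      Finset.Nat.sum_antidiagonal_eq_sum_range_succ (fun i j => k i * (x j / w j))]
    refine mul_right_cancel₀ (hwc n) ?_
    rw [← hval n, tsum_eq_sum (s := Finset.range (n + 1)), Finset.sum_mul]
    · refine Finset.sum_congr rfl fun m hm => ?_
      have hm' : m ≤ n := Nat.lt_succ_iff.1 (Finset.mem_range.1 hm)
      simp only [weightedTranslate, hm', if_true]
      push_cast
      ring
    · intro m hm
      have hm' : ¬ m ≤ n := by simpa using hm
      simp [weightedTranslate, hm']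
  have hk0 : PowerSeries.mk k ≠ 0 := by
    intro h
    refine hz 0 ?_ ?_
    · rw [norm_zero]
      exact Real.iInf_nonneg fun n => Real.rpow_nonneg (hw_pos _).le _
    · have hk' : ∀ n, k n = 0 := fun n => by simpa using congrArg (PowerSeries.coeff n) h
      simp [hk']
  have hfx : ∀ n, f n * (w n : ℂ) = x n := fun n => by
    have h := congrArg (PowerSeries.coeff n) (mul_left_cancel₀ hk0 hmul)
    simp only [PowerSeries.coeff_mk] at h
    rw [← h, div_mul_cancel₀ _ (hwc n)]
  simpa only [hfx] using x.tendsto_atTop
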